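/- Let λ > 0, Σ a symmetric positive definite real k×k matrix, Ψ a symmetric positive definite real n×n matrix, and M a real k×n matrix. Let W have the standard Gamma distribution with shape parameter λ and let X be a random real k×n matrix, independent of W, such that vec(X) is a centered multivariate Gaussian vector with covariance matrix Ψ ⊗ Σ. Set Y = W·M + √W·X. Then for every real k×n matrix T, E[exp(i·tr(Tᵀ Y))] = (1 + ½·tr(Ψ Tᵀ Σ T) − i·tr(Mᵀ T))^{−λ}, with the principal complex power. -/

import Mathlib

open MeasureTheory ProbabilityTheory Matrix Complex
open scoped Kronecker

/-- The (pi-type) measurable space structure on real matrices. -/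
instance matrixMeasurableSpace {m n : Type*} : MeasurableSpace (Matrix m n ℝ) :=
  MeasurableSpace.pi

/-- The vectorization of a real `k × n` matrix: the vector indexed by pairs
`(j, i) ∈ Fin n × Fin k` with entry `vecM A (j, i) = A i j` (columns stacked). -/
def vecM {k n : ℕ} (A : Matrix (Fin k) (Fin n) ℝ) : Fin n × Fin k → ℝ :=
  fun p => A p.2 p.1

/-- The measure `μ` on `ι → ℝ` is the centered multivariate Gaussian measure with
covariance matrix `S`, characterized by its characteristic function
`t ↦ exp(−½ tᵀ S t)`. -/
def IsCenteredGaussianLaw {ι : Type*} [Fintype ι] (μ : Measure (ι → ℝ))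
    (S : Matrix ι ι ℝ) : Prop :=
  IsProbabilityMeasure μ ∧
    ∀ t : ι → ℝ, ∫ x, Complex.exp (Complex.I * ((t ⬝ᵥ x : ℝ) : ℂ)) ∂μ =
      Complex.exp (-(1 / 2 : ℂ) * ((t ⬝ᵥ S.mulVec t : ℝ) : ℂ))

lemma measurable_gammaPDF (a r : ℝ) : Measurable (gammaPDF a r) :=
  (measurable_gammaPDFReal a r).ennreal_ofReal

lemma gammaMeasure_ae_nonneg (a r : ℝ) : ∀ᵐ w ∂(gammaMeasure a r), 0 ≤ w := by
  rw [gammaMeasure, ae_withDensity_iff (measurable_gammaPDF a r)]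
  refine .of_forall fun w hw => ?_
  contrapose! hw
  exact gammaPDF_of_neg hw

lemma mgf_id_gammaMeasure {a r x : ℝ} (ha : 0 < a) (hr : 0 < r) (hx : x < r) :
    mgf id (gammaMeasure a r) x = r ^ a * (r - x) ^ (-a) := by
  have hrx : 0 < r - x := sub_pos.2 hx
  have hG : Real.Gamma a ≠ 0 := (Real.Gamma_pos_of_pos ha).ne'
  have h := Real.integral_rpow_mul_exp_neg_mul_Ioi ha hrx
  rw [mgf, gammaMeasure, integral_withDensity_eq_integral_toReal_smul
    (measurable_gammaPDF a r)
    (.of_forall fun _ => ENNReal.ofReal_lt_top)]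
  calc ∫ w, (gammaPDF a r w).toReal • Real.exp (x * id w)
      = ∫ w in Set.Ici 0, r ^ a / Real.Gamma a *
          (w ^ (a - 1) * Real.exp (-((r - x) * w))) := by
        rw [← integral_indicator measurableSet_Ici]
        congr 1 with w
        rw [gammaPDF, ENNReal.toReal_ofReal (gammaPDFReal_nonneg ha hr w)]
        by_cases hw : 0 ≤ w
        · rw [Set.indicator_of_mem (by exact hw), gammaPDFReal, if_pos hw, smul_eq_mul,
            show -((r - x) * w) = -(r * w) + x * w by ring, Real.exp_add, id]
          ring
        · rw [Set.indicator_of_notMem (by exact hw), gammaPDFReal, if_neg hw, zero_smul]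
    _ = r ^ a * (r - x) ^ (-a) := by
        rw [integral_Ici_eq_integral_Ioi, integral_const_mul, h, one_div,
          Real.inv_rpow hrx.le, Real.rpow_neg hrx.le]
        field_simp

lemma Iio_subset_interior_integrableExpSet_gammaMeasure {a r : ℝ} (ha : 0 < a) (hr : 0 < r) :
    Set.Iio r ⊆ interior (integrableExpSet id (gammaMeasure a r)) := by
  refine interior_maximal (fun x hx => ?_) isOpen_Iio
  by_contra h
  have h0 : mgf id (gammaMeasure a r) x = 0 := integral_undef h
  rw [mgf_id_gammaMeasure ha hr hx] at h0
  have : 0 < r ^ a * (r - x) ^ (-a) :=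
    mul_pos (Real.rpow_pos_of_pos hr _) (Real.rpow_pos_of_pos (sub_pos.2 hx) _)
  exact this.ne' h0

lemma complexMGF_id_gammaMeasure {a r : ℝ} (ha : 0 < a) (hr : 0 < r) {z : ℂ} (hz : z.re < r) :
    complexMGF id (gammaMeasure a r) z = (r : ℂ) ^ (a : ℂ) * ((r : ℂ) - z) ^ (-(a : ℂ)) := by
  have hF : AnalyticOnNhd ℂ (complexMGF id (gammaMeasure a r)) {z | z.re < r} :=
    analyticOnNhd_complexMGF.mono fun z hz =>
      Iio_subset_interior_integrableExpSet_gammaMeasure ha hr hz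
  have hG : AnalyticOnNhd ℂ (fun z : ℂ => (r : ℂ) ^ (a : ℂ) * ((r : ℂ) - z) ^ (-(a : ℂ)))
      {z | z.re < r} := fun z hz =>
    analyticAt_const.mul ((analyticAt_const.sub analyticAt_id).cpow analyticAt_const
      (Or.inl (by simpa using hz)))
  refine hF.eqOn_of_preconnected_of_frequently_eq hG
    (((convex_Iio r).linear_preimage reLm).isPreconnected)
    (z₀ := ((0 : ℝ) : ℂ)) (by simpa using hr) ?_ hz
  have h_real : ∀ᶠ x : ℝ in nhdsWithin 0 {0}ᶜ, complexMGF id (gammaMeasure a r) x =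
      (r : ℂ) ^ (a : ℂ) * ((r : ℂ) - x) ^ (-(a : ℂ)) := by
    filter_upwards [nhdsWithin_le_nhds (Iio_mem_nhds hr)] with x hx
    rw [complexMGF_ofReal, mgf_id_gammaMeasure ha hr hx, ofReal_mul, ofReal_cpow hr.le,
      ofReal_cpow (sub_pos.2 hx).le, ofReal_sub, ofReal_neg]
  refine Filter.Tendsto.frequently ?_ h_real.frequently
  exact tendsto_nhdsWithin_of_tendsto_nhds_of_eventually_within _
    ((continuous_ofReal.tendsto 0).mono_left nhdsWithin_le_nhds)
    (eventually_nhdsWithin_of_forall fun x hx => by simpa using hx)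

lemma vecM_dotProduct_kronecker_mulVec {k n : ℕ} (S : Matrix (Fin k) (Fin k) ℝ)
    (Ψ : Matrix (Fin n) (Fin n) ℝ) (hΨ : Ψ.IsSymm) (T : Matrix (Fin k) (Fin n) ℝ) :
    vecM T ⬝ᵥ (Ψ ⊗ₖ S) *ᵥ vecM T = trace (Ψ * Tᵀ * S * T) := by
  change vec T ⬝ᵥ (Ψ ⊗ₖ S) *ᵥ vec T = _
  rw [kronecker_mulVec_vec, vec_dotProduct_vec, hΨ.eq, ← Matrix.mul_assoc, trace_mul_comm]
  simp only [Matrix.mul_assoc]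

lemma measurable_vecM {k n : ℕ} :
    Measurable (vecM : Matrix (Fin k) (Fin n) ℝ → Fin n × Fin k → ℝ) :=
  measurable_pi_lambda _ fun p => (measurable_pi_apply p.1).comp (measurable_pi_apply p.2)

lemma integral_exp_trace_of_isCenteredGaussianLaw {k n : ℕ}
    {μ : Measure (Matrix (Fin k) (Fin n) ℝ)} {C : Matrix (Fin n × Fin k) (Fin n × Fin k) ℝ}
    (h : IsCenteredGaussianLaw (μ.map vecM) C) (T : Matrix (Fin k) (Fin n) ℝ) (s : ℝ) :
    ∫ A, Complex.exp (I * ((s * trace (Tᵀ * A) : ℝ) : ℂ)) ∂μ =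
      Complex.exp (-(1 / 2 : ℂ) * ((s ^ 2 * (vecM T ⬝ᵥ C *ᵥ vecM T) : ℝ) : ℂ)) := by
  have h1 := h.2 (s • vecM T)
  rw [integral_map measurable_vecM.aemeasurable
    (by refine Continuous.aestronglyMeasurable ?_; fun_prop)] at h1
  simp only [mulVec_smul, smul_dotProduct, dotProduct_smul, smul_eq_mul, ← mul_assoc] at h1
  rw [pow_two, ← h1]
  simp only [← vec_dotProduct_vec]
  rfl

/-- If `W ∼ Gamma(λ, 1)` and `X` is a random `k × n` matrix, independent of `W`, with
`vec(X)` centered Gaussian with covariance `Ψ ⊗ Σ`, then `Y = W M + √W X` has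
characteristic function `T ↦ (1 + ½ tr(Ψ Tᵀ Σ T) − i tr(Mᵀ T))^{−λ}` (principal power). -/
theorem charFun_matrix_generalized_asymmetric_laplace {Ω : Type*} [MeasurableSpace Ω]
    (P : Measure Ω) [IsProbabilityMeasure P] {k n : ℕ} {lam : ℝ} (hlam : 0 < lam)
    (S : Matrix (Fin k) (Fin k) ℝ) (Ψ : Matrix (Fin n) (Fin n) ℝ)
    (hS : S.PosDef) (hSs : S.IsSymm) (hΨ : Ψ.PosDef) (hΨs : Ψ.IsSymm)
    (M : Matrix (Fin k) (Fin n) ℝ)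
    (W : Ω → ℝ) (X : Ω → Matrix (Fin k) (Fin n) ℝ)
    (hWm : Measurable W) (hXm : Measurable X)
    (hW : P.map W = gammaMeasure lam 1)
    (hX : IsCenteredGaussianLaw (P.map fun ω => vecM (X ω)) (Ψ ⊗ₖ S))
    (hindep : IndepFun W X P)
    (Y : Ω → Matrix (Fin k) (Fin n) ℝ)
    (hY : Y = fun ω => W ω • M + Real.sqrt (W ω) • X ω) :
    ∀ T : Matrix (Fin k) (Fin n) ℝ,
      ∫ ω, Complex.exp (Complex.I * ((Matrix.trace (Tᵀ * Y ω) : ℝ) : ℂ)) ∂P =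
        (1 + (1 / 2 : ℂ) * ((Matrix.trace (Ψ * Tᵀ * S * T) : ℝ) : ℂ)
          - Complex.I * ((Matrix.trace (Mᵀ * T) : ℝ) : ℂ)) ^ (-(lam : ℂ)) := by
  intro T
  subst hY
  have hprod : P.map (fun ω => (W ω, X ω)) = (gammaMeasure lam 1).prod (P.map X) := by
    rw [(indepFun_iff_map_prod_eq_prod_map_map hWm.aemeasurable hXm.aemeasurable).1 hindep, hW]
  have := isProbabilityMeasure_gammaMeasure hlam one_pos
  have := Measure.isProbabilityMeasure_map (μ := P) hXm.aemeasurable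
  have hXlaw : IsCenteredGaussianLaw ((P.map X).map vecM) (Ψ ⊗ₖ S) := by
    rwa [Measure.map_map measurable_vecM hXm]
  set q : ℝ := trace (Ψ * Tᵀ * S * T) with hq
  set m : ℝ := trace (Mᵀ * T) with hm
  have hq0 : 0 ≤ q := by
    rw [hq, ← vecM_dotProduct_kronecker_mulVec S Ψ hΨs T]
    exact (hΨ.posSemidef.kronecker hS.posSemidef).dotProduct_mulVec_nonneg (vecM T)
  have htr : ∀ (w : ℝ) (A : Matrix (Fin k) (Fin n) ℝ),
      trace (Tᵀ * (w • M + √w • A)) = w * m + √w * trace (Tᵀ * A) := fun w A => by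
    rw [Matrix.mul_add, trace_add, Matrix.mul_smul, Matrix.mul_smul, trace_smul, trace_smul,
      smul_eq_mul, smul_eq_mul, hm, ← trace_transpose (Mᵀ * T), transpose_mul,
      transpose_transpose]
  have htrm : Measurable fun A : Matrix (Fin k) (Fin n) ℝ => trace (Tᵀ * A) := by
    simp only [← vec_dotProduct_vec]
    exact (Continuous.measurable (by fun_prop :
      Continuous fun v : Fin n × Fin k → ℝ => vec T ⬝ᵥ v)).comp measurable_vecM
  let f : ℝ × Matrix (Fin k) (Fin n) ℝ → ℂ := fun p =>
    Complex.exp (I * ((p.1 * m + √p.1 * trace (Tᵀ * p.2) : ℝ) : ℂ))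
  have hfm : Measurable f := by
    have : Measurable fun p : ℝ × Matrix (Fin k) (Fin n) ℝ => trace (Tᵀ * p.2) :=
      htrm.comp measurable_snd
    fun_prop
  have hf : Integrable f ((gammaMeasure lam 1).prod (P.map X)) := by
    refine Integrable.of_bound hfm.aestronglyMeasurable 1 (.of_forall fun p => ?_)
    simp only [f]
    rw [mul_comm I, norm_exp_ofReal_mul_I]
  calc ∫ ω, Complex.exp (I * ((trace (Tᵀ * (W ω • M + √(W ω) • X ω)) : ℝ) : ℂ)) ∂P
      = ∫ p, f p ∂(P.map fun ω => (W ω, X ω)) := by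
        rw [integral_map (hWm.prodMk hXm).aemeasurable hfm.aestronglyMeasurable]
        simp only [htr, f]
    _ = ∫ w, ∫ A, f (w, A) ∂(P.map X) ∂(gammaMeasure lam 1) := by
        rw [hprod, integral_prod f hf]
    _ = complexMGF id (gammaMeasure lam 1) (I * m - 1 / 2 * q) := by
        refine integral_congr_ae ?_
        filter_upwards [gammaMeasure_ae_nonneg lam 1] with w hw
        simp only [f, ofReal_add (w * m), mul_add, Complex.exp_add]
        rw [integral_const_mul, integral_exp_trace_of_isCenteredGaussianLaw hXlaw,
          Real.sq_sqrt hw, vecM_dotProduct_kronecker_mulVec S Ψ hΨs T, ← hq, ← Complex.exp_add,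
          id]
        push_cast
        ring_nf
    _ = _ := by
        rw [complexMGF_id_gammaMeasure hlam one_pos (by simp; linarith)]
        simp only [ofReal_one, one_cpow, one_mul]
        ring_nf
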